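/- A Schwartz function ψ : ℝ³ → ℝ can be written as ψ = div Ψ for some Schwartz vector field Ψ : ℝ³ → ℝ³ if and only if ∫_{ℝ³} ψ = 0. -/

import Mathlib

open MeasureTheory

namespace DivSchwartz

open SchwartzMap LineDeriv FourierTransform Topology
open scoped ContDiff

/-- Weighted average of `F` along the ray from `0` to `x`. -/
noncomputable def rayAvg {E G : Type} [NormedAddCommGroup E] [NormedSpace ℝ E]
    [NormedAddCommGroup G] [NormedSpace ℝ G] (k : ℕ) (F : E → G) (x : E) : G :=
  ∫ t in (0 : ℝ)..1, t ^ k • F (t • x)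

section Ray

variable {E : Type} [NormedAddCommGroup E] [NormedSpace ℝ E]

lemma rayAvg_bound {G : Type} [NormedAddCommGroup G] [NormedSpace ℝ G]
    (k : ℕ) (F : SchwartzMap E G) : ∃ C, ∀ x, ‖rayAvg k F x‖ ≤ C := by
  refine ⟨SchwartzMap.seminorm ℝ 0 0 F, fun x => ?_⟩
  have := intervalIntegral.norm_integral_le_of_norm_le_const (a := (0 : ℝ)) (b := 1)
    (f := fun t : ℝ => t ^ k • F (t • x)) (C := SchwartzMap.seminorm ℝ 0 0 F) ?_
  · simpa [rayAvg] using this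
  · intro t ht
    rw [Set.uIoc_of_le zero_le_one] at ht
    rw [norm_smul, norm_pow, Real.norm_of_nonneg ht.1.le]
    calc t ^ k * ‖F (t • x)‖ ≤ 1 * SchwartzMap.seminorm ℝ 0 0 F := by
          gcongr
          · exact pow_le_one₀ ht.1.le ht.2
          · exact SchwartzMap.norm_le_seminorm ℝ F _
      _ = _ := one_mul _

lemma rayAvg_hasFDerivAt {G : Type} [NormedAddCommGroup G] [NormedSpace ℝ G]
    (k : ℕ) (F : SchwartzMap E G) (x : E) :
    HasFDerivAt (rayAvg k F) (rayAvg (k + 1) (fderivCLM ℝ E G F) x) x := by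
  have hc : ∀ x : E, Continuous fun t : ℝ => t ^ k • F (t • x) := fun x => by
    have := F.continuous
    fun_prop
  have hc' : Continuous fun t : ℝ => t ^ (k + 1) • fderivCLM ℝ E G F (t • x) := by
    have := (fderivCLM ℝ E G F).continuous
    fun_prop
  refine intervalIntegral.hasFDerivAt_integral_of_dominated_of_fderiv_le
    (F' := fun x (t : ℝ) => t ^ (k + 1) • fderivCLM ℝ E G F (t • x))
    (bound := fun _ => SchwartzMap.seminorm ℝ 0 0 (fderivCLM ℝ E G F))
    (s := Set.univ) Filter.univ_mem
    (Filter.Eventually.of_forall fun y => (hc y).aestronglyMeasurable)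
    ((hc x).intervalIntegrable _ _) hc'.aestronglyMeasurable ?_ (by simp) ?_
  · refine Filter.Eventually.of_forall fun t ht y _ => ?_
    rw [Set.uIoc_of_le zero_le_one] at ht
    rw [norm_smul, norm_pow, Real.norm_of_nonneg ht.1.le]
    calc t ^ (k + 1) * ‖fderivCLM ℝ E G F (t • y)‖
        ≤ 1 * SchwartzMap.seminorm ℝ 0 0 (fderivCLM ℝ E G F) := by
          gcongr
          · exact pow_le_one₀ ht.1.le ht.2
          · exact SchwartzMap.norm_le_seminorm ℝ _ _
      _ = _ := one_mul _
  · refine Filter.Eventually.of_forall fun t ht y _ => ?_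
    have h1 : HasFDerivAt (fun y : E => t • y) (t • ContinuousLinearMap.id ℝ E) y :=
      (hasFDerivAt_id y).const_smul t
    have h2 := ((F.hasFDerivAt (t • y)).comp y h1).const_smul (t ^ k)
    refine HasFDerivAt.congr_fderiv h2 ?_
    ext v
    simp [pow_succ, mul_smul]

lemma rayAvg_fderiv {G : Type} [NormedAddCommGroup G] [NormedSpace ℝ G]
    (k : ℕ) (F : SchwartzMap E G) :
    fderiv ℝ (rayAvg k F) = rayAvg (k + 1) (fderivCLM ℝ E G F) :=
  funext fun x => (rayAvg_hasFDerivAt k F x).fderiv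

lemma rayAvg_contDiff (n : ℕ) : ∀ {G : Type} [NormedAddCommGroup G] [NormedSpace ℝ G]
    (k : ℕ) (F : SchwartzMap E G), ContDiff ℝ n (rayAvg k F) := by
  induction n with
  | zero =>
    intro G _ _ k F
    exact contDiff_zero.2 (continuous_iff_continuousAt.2 fun x =>
      (rayAvg_hasFDerivAt k F x).continuousAt)
  | succ n ih =>
    intro G _ _ k F
    push_cast
    rw [contDiff_succ_iff_fderiv]
    refine ⟨fun x => (rayAvg_hasFDerivAt k F x).differentiableAt, by simp, ?_⟩
    rw [rayAvg_fderiv]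
    exact ih _ _

lemma rayAvg_iter_bound (n : ℕ) : ∀ {G : Type} [NormedAddCommGroup G] [NormedSpace ℝ G]
    (k : ℕ) (F : SchwartzMap E G), ∃ C, ∀ x, ‖iteratedFDeriv ℝ n (rayAvg k F) x‖ ≤ C := by
  induction n with
  | zero =>
    intro G _ _ k F
    simpa using rayAvg_bound k F
  | succ n ih =>
    intro G _ _ k F
    obtain ⟨C, hC⟩ := ih (k + 1) (fderivCLM ℝ E G F)
    refine ⟨C, fun x => ?_⟩
    rw [← norm_iteratedFDeriv_fderiv, rayAvg_fderiv]
    exact hC x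

lemma rayAvg_temperate {G : Type} [NormedAddCommGroup G] [NormedSpace ℝ G]
    (k : ℕ) (F : SchwartzMap E G) : (rayAvg k F).HasTemperateGrowth := by
  refine ⟨contDiff_infty.2 fun n => rayAvg_contDiff n k F, fun n => ?_⟩
  obtain ⟨C, hC⟩ := rayAvg_iter_bound n k F
  exact ⟨0, C, by simpa using hC⟩

/-- Hadamard's lemma. -/
lemma hadamard {G : Type} [NormedAddCommGroup G] [NormedSpace ℝ G] [CompleteSpace G]
    (F : SchwartzMap E G) (x : E) :
    rayAvg 0 (fderivCLM ℝ E G F) x x = F x - F 0 := by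
  have hc' : Continuous fun t : ℝ => fderivCLM ℝ E G F (t • x) := by
    have := (fderivCLM ℝ E G F).continuous
    fun_prop
  have h := intervalIntegral.integral_eq_sub_of_hasDerivAt (a := (0 : ℝ)) (b := 1)
    (f := fun t : ℝ => F (t • x)) (f' := fun t => fderivCLM ℝ E G F (t • x) x) ?_ ?_
  · rw [rayAvg]
    simp only [pow_zero, one_smul]
    rw [ContinuousLinearMap.intervalIntegral_apply (hc'.intervalIntegrable _ _), h]
    simp
  · intro t _
    have h1 : HasDerivAt (fun t : ℝ => t • x) x t := by
      simpa using (hasDerivAt_id t).smul_const x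
    exact (F.hasFDerivAt (t • x)).comp_hasDerivAt t h1
  · exact (hc'.clm_apply continuous_const).intervalIntegrable _ _

end Ray

abbrev V := EuclideanSpace ℝ (Fin 3)

noncomputable abbrev e (i : Fin 3) : V := EuclideanSpace.single i 1

lemma clm_apply_sum (L : V →L[ℝ] ℂ) (x : V) :
    L x = ∑ i, (inner ℝ x (e i)) • L (e i) := by
  have hx : x = ∑ i, (inner ℝ x (e i)) • e i := by
    ext j
    simp [e, EuclideanSpace.inner_single_right, Finset.sum_apply, Pi.single_apply]
  conv_lhs => rw [hx]
  simp

lemma exists_cutoff : ∃ φ : SchwartzMap V ℂ, φ 0 = 1 := by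
  let b : ContDiffBump (0 : V) := ⟨1, 2, by norm_num, by norm_num⟩
  have h : ContDiff ℝ ∞ (b : V → ℝ) := b.contDiff
  refine ⟨postcompCLM Complex.ofRealCLM (b.hasCompactSupport.toSchwartzMap h), ?_⟩
  have : b (0 : V) = 1 := b.one_of_mem_closedBall (by simp [b])
  simp [this]

lemma decomp (f : SchwartzMap V ℂ) (hf : f 0 = 0) :
    ∃ h : Fin 3 → SchwartzMap V ℂ, f = ∑ i, smulLeftCLM ℂ (inner ℝ · (e i)) (h i) := by
  obtain ⟨φ, hφ⟩ := exists_cutoff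
  have ht : ∀ (g : SchwartzMap V ℂ) (i : Fin 3),
      (fun x => rayAvg 0 (fderivCLM ℝ V ℂ g) x (e i)).HasTemperateGrowth := fun g i =>
    (ContinuousLinearMap.hasTemperateGrowth (ContinuousLinearMap.apply ℝ ℂ (e i))).comp
      (rayAvg_temperate 0 (fderivCLM ℝ V ℂ g))
  refine ⟨fun i => smulLeftCLM ℂ (fun x => rayAvg 0 (fderivCLM ℝ V ℂ f) x (e i)) φ
    - smulLeftCLM ℂ (fun x => rayAvg 0 (fderivCLM ℝ V ℂ φ) x (e i)) f, ?_⟩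
  ext x
  have hi : ∀ i, (inner ℝ · (e i) : V → ℝ).HasTemperateGrowth := fun i => by fun_prop
  have h1 := hadamard f x
  have h2 := hadamard φ x
  rw [clm_apply_sum] at h1 h2
  rw [hf, sub_zero] at h1
  rw [hφ] at h2
  simp only [_root_.sum_apply, smulLeftCLM_apply_apply (hi _), _root_.sub_apply,
    smulLeftCLM_apply_apply (ht _ _), smul_sub, Finset.sum_sub_distrib, smul_eq_mul,
    ← smul_mul_assoc, ← Finset.sum_mul, h1, h2]
  ring

lemma fourier_at_zero (f : SchwartzMap V ℂ) : (𝓕 f) 0 = ∫ x, f x := by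
  rw [fourier_coe, Real.fourier_eq']
  simp

lemma fourier_deriv_zero (f : SchwartzMap V ℂ) (v : V) : ∫ x, (∂_{v} f) x = 0 := by
  rw [← fourier_at_zero, fourier_lineDerivOp_eq]
  have : (inner ℝ · v : V → ℝ).HasTemperateGrowth := by fun_prop
  simp [this]

lemma complex_div (f : SchwartzMap V ℂ) (hf : ∫ x, f x = 0) :
    ∃ g : Fin 3 → SchwartzMap V ℂ, f = ∑ i, ∂_{e i} (g i) := by
  obtain ⟨h, hh⟩ := decomp (𝓕 f) (by rw [fourier_at_zero, hf])
  refine ⟨fun i => 𝓕⁻ (((2 * Real.pi * Complex.I)⁻¹ : ℂ) • h i), ?_⟩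
  have hi : ∀ i, (inner ℝ · (e i) : V → ℝ).HasTemperateGrowth := fun i => by fun_prop
  have key : ∀ i, ∂_{e i} (𝓕⁻ (((2 * Real.pi * Complex.I)⁻¹ : ℂ) • h i))
      = 𝓕⁻ (smulLeftCLM ℂ (inner ℝ · (e i)) (h i)) := by
    intro i
    rw [lineDerivOp_fourierInv_eq]
    congr 1
    ext x
    have : (2 * Real.pi * Complex.I : ℂ) ≠ 0 := Complex.two_pi_I_ne_zero
    simp [hi]
    field_simp
    simp
  simp_rw [key]
  have := congrArg (fourierInvCLM ℂ (SchwartzMap V ℂ)) hh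
  simpa [map_sum] using this

end DivSchwartz

open DivSchwartz SchwartzMap LineDeriv in
/-- A Schwartz function `ψ : ℝ³ → ℝ` can be written as `ψ = div Ψ` for some
Schwartz vector field `Ψ : ℝ³ → ℝ³` if and only if `∫ ψ = 0`.  The divergence of a vector
field `Ψ` is `div Ψ = ∑ i, ∂ᵢ Ψ^i`. -/
theorem schwartz_eq_div_iff_integral_zero
    (ψ : SchwartzMap (EuclideanSpace ℝ (Fin 3)) ℝ) :
    (∃ Ψ : SchwartzMap (EuclideanSpace ℝ (Fin 3)) (EuclideanSpace ℝ (Fin 3)),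
        ∀ x, (∑ i : Fin 3, fderiv ℝ (⇑Ψ) x (EuclideanSpace.single i 1) i) = ψ x)
      ↔ (∫ x, ψ x) = 0 := by
  constructor
  · rintro ⟨Ψ, hΨ⟩
    let L : Fin 3 → (V →L[ℝ] ℂ) := fun i => Complex.ofRealCLM.comp (EuclideanSpace.proj i)
    have h1 : ∀ i x, (∂_{e i} (postcompCLM (L i) Ψ)) x
        = ((fderiv ℝ (⇑Ψ) x (EuclideanSpace.single i 1) i : ℝ) : ℂ) := by
      intro i x
      rw [lineDerivOp_apply_eq_fderiv]
      have : HasFDerivAt (postcompCLM (L i) Ψ) ((L i).comp (fderiv ℝ Ψ x)) x :=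
        (L i).hasFDerivAt.comp x (Ψ.hasFDerivAt x)
      rw [this.fderiv]
      simp [L]
    have h2 : ((∫ x, ψ x : ℝ) : ℂ) = 0 := by
      rw [← integral_complex_ofReal]
      simp_rw [← hΨ, Complex.ofReal_sum, ← h1]
      rw [integral_finsetSum _ fun i _ => SchwartzMap.integrable _]
      simp [fourier_deriv_zero]
    exact_mod_cast h2
  · intro h
    obtain ⟨g, hg⟩ := complex_div (postcompCLM Complex.ofRealCLM ψ) (by
      simp only [postcompCLM_apply, Complex.ofRealCLM_apply]
      rw [integral_complex_ofReal, h]; simp)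
    let L : Fin 3 → (ℂ →L[ℝ] V) := fun i => Complex.reCLM.smulRight (e i)
    refine ⟨∑ i, postcompCLM (L i) (g i), fun x => ?_⟩
    have h1 : HasFDerivAt (⇑(∑ i, postcompCLM (L i) (g i)))
        (∑ i, (L i).comp (fderiv ℝ (g i) x)) x := by
      have := HasFDerivAt.fun_sum (u := Finset.univ) fun i _ =>
        (L i).hasFDerivAt.comp x ((g i).hasFDerivAt x)
      have hfun : ⇑(∑ i, postcompCLM (L i) (g i)) = fun y => ∑ i, (⇑(L i) ∘ ⇑(g i)) y := by
        funext y
        simp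
      rw [hfun]
      exact this
    rw [h1.fderiv]
    have h2 := congrArg (fun F : SchwartzMap V ℂ => (F x).re) hg
    simp only [postcompCLM_apply, Complex.ofRealCLM_apply, Complex.ofReal_re,
      _root_.sum_apply, Complex.re_sum, lineDerivOp_apply_eq_fderiv] at h2
    rw [h2]
    refine Finset.sum_congr rfl fun i _ => ?_
    simp [L, e, Pi.single_apply]
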